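/- arXiv:1707.08647 — 4 statements merged into one kernel-verified Lean document; each statement's English description precedes it below -/
import Mathlib

section
/- Let A, B, C, D : ℂ² → ℂ be functions invariant under κ, ρ, and all phase shifts R_φ (i.e. F(γ(z)) = F(z) for F ∈ {A, B, C, D} and γ ∈ {κ, ρ, R_φ for every φ ∈ ℝ}). Then the map g : ℂ² → ℂ² defined by g(z₁, z₂) = A(z)·(z₁, z₂) + B(z)·(z₁²z̄₁, z₂²z̄₂) + C(z)·(z̄₁³z₂⁴, z₁⁴z̄₂³) + D(z)·(z₁⁵z̄₂⁴, z̄₁⁴z₂⁵) is equivariant under the D₈ × S¹ action: g(κ(z)) = κ(g(z)), g(ρ(z)) = ρ(g(z)), and g(R_φ(z)) = R_φ(g(z)) for all z ∈ ℂ² and all φ ∈ ℝ. -/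
open Complex

/-- If `A, B, C, D : ℂ² → ℂ` are invariant under `κ`, `ρ` and all phase shifts
`R_φ`, then the map
`g(z₁, z₂) = A·(z₁, z₂) + B·(z₁²z̄₁, z₂²z̄₂) + C·(z̄₁³z₂⁴, z₁⁴z̄₂³) + D·(z₁⁵z̄₂⁴, z̄₁⁴z₂⁵)`
is equivariant under the `D₈ × S¹` action generated by `κ`, `ρ` and the `R_φ`. -/
theorem D8S1_equivariant_map
    (κ ρ : ℂ × ℂ → ℂ × ℂ) (R : ℝ → (ℂ × ℂ) → (ℂ × ℂ))
    (hκ : ∀ z, κ z = (z.2, z.1))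
    (hρ : ∀ z, ρ z = (Complex.I * z.1, -Complex.I * z.2))
    (hR : ∀ φ z, R φ z = (Complex.exp (φ * Complex.I) * z.1,
      Complex.exp (φ * Complex.I) * z.2))
    (A B C D : ℂ × ℂ → ℂ)
    (hAκ : ∀ z, A (κ z) = A z) (hAρ : ∀ z, A (ρ z) = A z)
    (hAR : ∀ φ z, A (R φ z) = A z)
    (hBκ : ∀ z, B (κ z) = B z) (hBρ : ∀ z, B (ρ z) = B z)
    (hBR : ∀ φ z, B (R φ z) = B z)
    (hCκ : ∀ z, C (κ z) = C z) (hCρ : ∀ z, C (ρ z) = C z)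
    (hCR : ∀ φ z, C (R φ z) = C z)
    (hDκ : ∀ z, D (κ z) = D z) (hDρ : ∀ z, D (ρ z) = D z)
    (hDR : ∀ φ z, D (R φ z) = D z)
    (g : ℂ × ℂ → ℂ × ℂ)
    (hg : ∀ z : ℂ × ℂ, g z =
      (A z * z.1 + B z * (z.1 ^ 2 * (starRingEnd ℂ) z.1)
        + C z * ((starRingEnd ℂ) z.1 ^ 3 * z.2 ^ 4)
        + D z * (z.1 ^ 5 * (starRingEnd ℂ) z.2 ^ 4),
       A z * z.2 + B z * (z.2 ^ 2 * (starRingEnd ℂ) z.2)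
        + C z * (z.1 ^ 4 * (starRingEnd ℂ) z.2 ^ 3)
        + D z * ((starRingEnd ℂ) z.1 ^ 4 * z.2 ^ 5))) :
    (∀ z, g (κ z) = κ (g z)) ∧ (∀ z, g (ρ z) = ρ (g z)) ∧
      (∀ φ z, g (R φ z) = R φ (g z)) := by
  refine ⟨fun z => ?_, fun z => ?_, fun φ z => ?_⟩
  · rw [hg (κ z), hAκ, hBκ, hCκ, hDκ, hκ, hκ, hg z]
    ext1 <;> ring
  · rw [hg (ρ z), hAρ, hBρ, hCρ, hDρ, hρ, hρ, hg z]
    have h2 : I ^ 2 = -1 := I_sq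
    have h3 : I ^ 3 = -I := I_pow_three
    have h4 : I ^ 4 = 1 := I_pow_four
    have h5 : I ^ 5 = I := by rw [pow_succ, h4, one_mul]
    ext1 <;> simp only [map_mul, map_neg, conj_I, mul_pow, neg_neg, h2, h3, h4, h5,
      Odd.neg_pow (by decide : Odd 3), Odd.neg_pow (by decide : Odd 5),
      Even.neg_pow (by decide : Even 2), Even.neg_pow (by decide : Even 4)] <;> ring
  · rw [hg (R φ z), hAR, hBR, hCR, hDR, hR, hR, hg z]
    have hu : exp (φ * I) * (starRingEnd ℂ) (exp (φ * I)) = 1 := by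
      rw [mul_conj, normSq_eq_norm_sq, norm_exp_ofReal_mul_I]
      norm_num
    generalize exp (φ * I) = u at hu ⊢
    have hB : u ^ 2 * (starRingEnd ℂ) u = u := by
      rw [pow_succ, mul_assoc, hu, pow_one, mul_one]
    have hC : u ^ 4 * (starRingEnd ℂ) u ^ 3 = u := by
      rw [pow_succ' u 3, mul_assoc, ← mul_pow, hu, one_pow, mul_one]
    have hD : u ^ 5 * (starRingEnd ℂ) u ^ 4 = u := by
      rw [pow_succ' u 4, mul_assoc, ← mul_pow, hu, one_pow, mul_one]
    ext1 <;> simp only [map_mul]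
    · linear_combination B z * (z.1 ^ 2 * (starRingEnd ℂ) z.1) * hB
        + C z * ((starRingEnd ℂ) z.1 ^ 3 * z.2 ^ 4) * hC
        + D z * (z.1 ^ 5 * (starRingEnd ℂ) z.2 ^ 4) * hD
    · linear_combination B z * (z.2 ^ 2 * (starRingEnd ℂ) z.2) * hB
        + C z * (z.1 ^ 4 * (starRingEnd ℂ) z.2 ^ 3) * hC
        + D z * ((starRingEnd ℂ) z.1 ^ 4 * z.2 ^ 5) * hD
end

section
/- The functions h₁(θ) = sin θ₁, h₂(θ) = sin θ₂, h₃(θ) = sin θ₃ are trigonometric invariant algebraic surfaces for the vector field X: there exist functions K₁, K₂, K₃ : ℝ³ → ℝ, namely K₁(θ) = cos θ₁·(u cos θ₂ + 2ε cos θ₁ cos 2θ₂), K₂(θ) = cos θ₂·(u cos θ₃ + 2ε cos θ₂ cos 2θ₃), K₃(θ) = cos θ₃·(u cos θ₁ + 2ε cos 2θ₁ cos θ₃ + 2q(1 − cos θ₁) cos θ₃), such that for every θ ∈ ℝ³ and each i ∈ {1, 2, 3}, the derivative of hᵢ along X satisfies X(θ) · ∇hᵢ(θ) = Kᵢ(θ)·hᵢ(θ).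 -/
open Real

/-- The derivative of `sin ∘ L` for a continuous linear functional `L`. -/
lemma fderiv_sin_clm_apply {E : Type*} [NormedAddCommGroup E] [NormedSpace ℝ E]
    (L : E →L[ℝ] ℝ) (x v : E) :
    fderiv ℝ (fun y => sin (L y)) x v = cos (L x) * L v := by
  rw [(L.hasFDerivAt (x := x)).sin.fderiv]
  simp

/-- The functions `h₁ = sin θ₁`, `h₂ = sin θ₂`, `h₃ = sin θ₃` are trigonometric
invariant algebraic surfaces for the vector field `X` of system (11): the
derivative of `hᵢ` along `X` equals `Kᵢ · hᵢ` for the indicated cofactors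
`K₁, K₂, K₃`. -/
theorem sin_invariant_algebraic_surfaces
    (u ε q : ℝ) (X : ℝ × ℝ × ℝ → ℝ × ℝ × ℝ)
    (hX : ∀ θ : ℝ × ℝ × ℝ, X θ =
      (u * sin θ.1 * cos θ.2.1 + ε * sin (2 * θ.1) * cos (2 * θ.2.1),
       u * sin θ.2.1 * cos θ.2.2 + ε * sin (2 * θ.2.1) * cos (2 * θ.2.2),
       u * sin θ.2.2 * cos θ.1 + ε * sin (2 * θ.2.2) * cos (2 * θ.1)
         + q * (1 - cos θ.1) * sin (2 * θ.2.2)))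
    (h₁ h₂ h₃ : ℝ × ℝ × ℝ → ℝ)
    (hh₁ : ∀ θ : ℝ × ℝ × ℝ, h₁ θ = sin θ.1)
    (hh₂ : ∀ θ : ℝ × ℝ × ℝ, h₂ θ = sin θ.2.1)
    (hh₃ : ∀ θ : ℝ × ℝ × ℝ, h₃ θ = sin θ.2.2)
    (K₁ K₂ K₃ : ℝ × ℝ × ℝ → ℝ)
    (hK₁ : ∀ θ : ℝ × ℝ × ℝ, K₁ θ = cos θ.1 * (u * cos θ.2.1 + 2 * ε * cos θ.1 * cos (2 * θ.2.1)))
    (hK₂ : ∀ θ : ℝ × ℝ × ℝ, K₂ θ = cos θ.2.1 * (u * cos θ.2.2 + 2 * ε * cos θ.2.1 * cos (2 * θ.2.2)))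
    (hK₃ : ∀ θ : ℝ × ℝ × ℝ, K₃ θ = cos θ.2.2 * (u * cos θ.1 + 2 * ε * cos (2 * θ.1) * cos θ.2.2
      + 2 * q * (1 - cos θ.1) * cos θ.2.2)) :
    ∀ θ : ℝ × ℝ × ℝ,
      fderiv ℝ h₁ θ (X θ) = K₁ θ * h₁ θ ∧
      fderiv ℝ h₂ θ (X θ) = K₂ θ * h₂ θ ∧
      fderiv ℝ h₃ θ (X θ) = K₃ θ * h₃ θ := by
  intro θ
  have hfst := fderiv_sin_clm_apply (ContinuousLinearMap.fst ℝ ℝ (ℝ × ℝ)) θ (X θ)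
  have hsnd := fderiv_sin_clm_apply
    ((ContinuousLinearMap.fst ℝ ℝ ℝ).comp (ContinuousLinearMap.snd ℝ ℝ (ℝ × ℝ))) θ (X θ)
  have hthd := fderiv_sin_clm_apply
    ((ContinuousLinearMap.snd ℝ ℝ ℝ).comp (ContinuousLinearMap.snd ℝ ℝ (ℝ × ℝ))) θ (X θ)
  simp only [ContinuousLinearMap.comp_apply, ContinuousLinearMap.coe_fst',
    ContinuousLinearMap.coe_snd'] at hfst hsnd hthd
  rw [funext hh₁, funext hh₂, funext hh₃, hfst, hsnd, hthd, hX, hK₁, hK₂, hK₃]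
  simp only [sin_two_mul]
  refine ⟨?_, ?_, ?_⟩ <;> ring
end

section
/- The linearization of X at the equilibrium (π, 0, 0) is diagonal: the Fréchet derivative of X at (π, 0, 0) is the linear map represented by the diagonal matrix diag(−u + 2ε, u + 2ε, −u + 2ε + 4q); in particular its eigenvalues are −u + 2ε, u + 2ε, and −u + 2ε + 4q. -/
open Real

/-- The linearization of the vector field `X` of system (11) at the equilibrium
`(π,0,0)` (the fixed point of the isotropy subgroup `Q̃₈ᵃ`) is the diagonal
matrix `diag(-u + 2ε, u + 2ε, -u + 2ε + 4q)`; in particular its eigenvalues are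
`-u + 2ε`, `u + 2ε` and `-u + 2ε + 4q`. -/
theorem linearization_at_pi_0_0
    (u ε q : ℝ) (X : ℝ × ℝ × ℝ → ℝ × ℝ × ℝ)
    (hX : ∀ θ : ℝ × ℝ × ℝ, X θ =
      (u * sin θ.1 * cos θ.2.1 + ε * sin (2 * θ.1) * cos (2 * θ.2.1),
       u * sin θ.2.1 * cos θ.2.2 + ε * sin (2 * θ.2.1) * cos (2 * θ.2.2),
       u * sin θ.2.2 * cos θ.1 + ε * sin (2 * θ.2.2) * cos (2 * θ.1)
         + q * (1 - cos θ.1) * sin (2 * θ.2.2))) :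
    ∀ v : ℝ × ℝ × ℝ, fderiv ℝ X (π, 0, 0) v
      = ((-u + 2 * ε) * v.1, (u + 2 * ε) * v.2.1, (-u + 2 * ε + 4 * q) * v.2.2) := by
  intro v
  obtain rfl : X = _ := funext hX
  have h₁ : HasFDerivAt (fun θ : ℝ × ℝ × ℝ => θ.1) _ (π, 0, 0) := hasFDerivAt_fst (𝕜 := ℝ)
  have h₂ : HasFDerivAt (fun θ : ℝ × ℝ × ℝ => θ.2.1) _ (π, 0, 0) :=
    (hasFDerivAt_snd (𝕜 := ℝ)).fst
  have h₃ : HasFDerivAt (fun θ : ℝ × ℝ × ℝ => θ.2.2) _ (π, 0, 0) :=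
    (hasFDerivAt_snd (𝕜 := ℝ)).snd
  have hd₁ := h₁.const_mul 2
  have hd₂ := h₂.const_mul 2
  have hd₃ := h₃.const_mul 2
  have hX₁ := ((h₁.sin.const_mul u).mul h₂.cos).add ((hd₁.sin.const_mul ε).mul hd₂.cos)
  have hX₂ := ((h₂.sin.const_mul u).mul h₃.cos).add ((hd₂.sin.const_mul ε).mul hd₃.cos)
  have hX₃ := (((h₃.sin.const_mul u).mul h₁.cos).add ((hd₃.sin.const_mul ε).mul hd₁.cos)).add
    (((h₁.cos.const_sub 1).const_mul q).mul hd₃.sin)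
  have hfderiv := (hX₁.prodMk (hX₂.prodMk hX₃)).fderiv
  refine (congrArg (fun L => L v) hfderiv).trans ?_
  ext <;> simp <;> ring
end

section
/- The linearization of X at the equilibrium (0, π, 0) is diagonal: the Fréchet derivative of X at (0, π, 0) is the linear map represented by the diagonal matrix diag(−u + 2ε, −u + 2ε, u + 2ε); in particular its eigenvalues are −u + 2ε (with multiplicity two) and u + 2ε. -/
open Real

/-- The linearization of the vector field `X` of system (11) at the equilibrium
`(0,π,0)` (the fixed point of the isotropy subgroup `Q̃₈ᵇ`) is the diagonal
matrix `diag(-u + 2ε, -u + 2ε, u + 2ε)`; in particular its eigenvalues are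
`-u + 2ε` (with multiplicity two) and `u + 2ε`. -/
theorem linearization_at_0_pi_0
    (u ε q : ℝ) (X : ℝ × ℝ × ℝ → ℝ × ℝ × ℝ)
    (hX : ∀ θ : ℝ × ℝ × ℝ, X θ =
      (u * sin θ.1 * cos θ.2.1 + ε * sin (2 * θ.1) * cos (2 * θ.2.1),
       u * sin θ.2.1 * cos θ.2.2 + ε * sin (2 * θ.2.1) * cos (2 * θ.2.2),
       u * sin θ.2.2 * cos θ.1 + ε * sin (2 * θ.2.2) * cos (2 * θ.1)
         + q * (1 - cos θ.1) * sin (2 * θ.2.2))) :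
    ∀ v : ℝ × ℝ × ℝ, fderiv ℝ X (0, π, 0) v
      = ((-u + 2 * ε) * v.1, (-u + 2 * ε) * v.2.1, (u + 2 * ε) * v.2.2) := by
  intro v
  have h₁ : HasFDerivAt (fun θ : ℝ × ℝ × ℝ => θ.1) _ (0, π, 0) :=
    hasFDerivAt_fst (𝕜 := ℝ)
  have h₂ : HasFDerivAt (fun θ : ℝ × ℝ × ℝ => θ.2.1) _ (0, π, 0) :=
    (hasFDerivAt_snd (𝕜 := ℝ)).fst
  have h₃ : HasFDerivAt (fun θ : ℝ × ℝ × ℝ => θ.2.2) _ (0, π, 0) :=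
    (hasFDerivAt_snd (𝕜 := ℝ)).snd
  have hX₁ := ((h₁.sin.const_mul u).mul h₂.cos).add
    (((h₁.const_mul 2).sin.const_mul ε).mul (h₂.const_mul 2).cos)
  have hX₂ := ((h₂.sin.const_mul u).mul h₃.cos).add
    (((h₂.const_mul 2).sin.const_mul ε).mul (h₃.const_mul 2).cos)
  have hX₃ := (((h₃.sin.const_mul u).mul h₁.cos).add
    (((h₃.const_mul 2).sin.const_mul ε).mul (h₁.const_mul 2).cos)).add
    (((h₁.cos.const_sub 1).const_mul q).mul (h₃.const_mul 2).sin)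
  have hderiv := (hX₁.prodMk (hX₂.prodMk hX₃)).congr_of_eventuallyEq
    (Filter.Eventually.of_forall hX)
  rw [hderiv.fderiv]
  ext <;> simp <;> ring
end
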